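/- For every τ > 0 and C_r > 0 there exists C = C(τ, C_r) > 0 with the following property. Let y ∈ ℝ³, let σ, σ̃ ≥ 0 and s, m > 0, and let f, r : ℝ³ → ℝ be measurable functions such that |r(x)| ≤ C_r |x−y|^σ for x ∈ B₁(y), |r(x)| ≤ C_r |x−y|^{σ̃} for x ∈ ℝ³ ∖ B₁(y), |f(x)| ≤ C_r |x|^{−s} for x ∈ B₁(0), and |f(x)| ≤ C_r |x|^{−m} for x ∈ ℝ³ ∖ B₁(0). If σ, σ̃ ≤ m − 3/2 − τ and s + τ < σ + 3/2, then for every μ > 0 and all v₁, v₂, v₃ ∈ C_c^∞(ℝ³) with ∫_{ℝ³} |∇v_i|² ≤ 1 for i = 1, 2, 3: ∫_{ℝ³} |r(x)| μ^{−3/2} |f((x−y)/μ)| |v₁(x)| |v₂(x)| |v₃(x)| dx ≤ C μ^σ if 0 < μ ≤ 1, and ≤ C (μ^{s−3/2} + μ^{σ̃}) if μ > 1. -/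

import Mathlib

open MeasureTheory

/-- Integration by parts against the position vector field `x - y`, whose divergence is the
dimension. -/
theorem integral_fderiv_apply_sub {ι : Type*} [Fintype ι] {g : EuclideanSpace ℝ ι → ℝ}
    (hg : ContDiff ℝ 1 g) (hc : HasCompactSupport g) (y : EuclideanSpace ℝ ι) :
    ∫ x, fderiv ℝ g x (x - y) = -(Fintype.card ι * ∫ x, g x) := by
  classical
  let e : ι → EuclideanSpace ℝ ι := fun i => EuclideanSpace.single i 1
  have hd : Continuous (fderiv ℝ g) := hg.continuous_fderiv one_ne_zero
  have hcoord (i : ι) : ∀ x, HasFDerivAt (fun x : EuclideanSpace ℝ ι => (x - y) i)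
      (EuclideanSpace.proj i : EuclideanSpace ℝ ι →L[ℝ] ℝ) x := fun x =>
    (EuclideanSpace.proj i : EuclideanSpace ℝ ι →L[ℝ] ℝ).hasFDerivAt.comp x
      ((hasFDerivAt_id x).sub_const y)
  have hcd (i : ι) : HasCompactSupport fun x => fderiv ℝ g x (e i) :=
    hc.fderiv_apply ℝ (e i)
  have hcont (i : ι) : Continuous fun x => fderiv ℝ g x (e i) := by fun_prop
  have hci (i : ι) : Continuous fun x : EuclideanSpace ℝ ι => (x - y) i := by fun_prop
  have hint (i : ι) : Integrable fun x => (x - y) i * fderiv ℝ g x (e i) :=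
    ((hci i).mul (hcont i)).integrable_of_hasCompactSupport (hcd i).mul_left
  have hparts (i : ι) : ∫ x, (x - y) i * fderiv ℝ g x (e i) = -∫ x, g x := by
    have hone : ∀ x, fderiv ℝ (fun x : EuclideanSpace ℝ ι => (x - y) i) x (e i) = 1 := by
      intro x
      rw [(hcoord i x).fderiv]
      simp [e]
    have := integral_mul_fderiv_eq_neg_fderiv_mul_of_integrable (μ := volume)
      (f := fun x : EuclideanSpace ℝ ι => (x - y) i) (g := g) (v := e i)
      (by simpa only [hone, one_mul] using hg.continuous.integrable_of_hasCompactSupport hc)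
      (hint i)
      (((hci i).mul hg.continuous).integrable_of_hasCompactSupport hc.mul_left)
      (fun x _ => (hcoord i x).differentiableAt)
      (fun x _ => hg.differentiable one_ne_zero x)
    simpa only [hone, one_mul] using this
  have hsum (x : EuclideanSpace ℝ ι) :
      fderiv ℝ g x (x - y) = ∑ i, (x - y) i * fderiv ℝ g x (e i) := by
    conv_lhs => rw [← (EuclideanSpace.basisFun ι ℝ).sum_repr (x - y)]
    simp [e, map_sum]
  simp_rw [hsum]
  rw [integral_finsetSum _ fun i _ => hint i]
  simp_rw [hparts]
  simp

theorem norm_gradient_eq_norm_fderiv {F : Type*} [NormedAddCommGroup F] [InnerProductSpace ℝ F]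
    [CompleteSpace F] (v : F → ℝ) (x : F) : ‖gradient v x‖ = ‖fderiv ℝ v x‖ := by
  simp [gradient]

theorem integrable_norm_fderiv_sq {n : ℕ} {v : EuclideanSpace ℝ (Fin n) → ℝ}
    (hv : ContDiff ℝ 1 v) (hc : HasCompactSupport v) :
    Integrable fun x => ‖fderiv ℝ v x‖ ^ 2 :=
  ((hv.continuous_fderiv one_ne_zero).norm.pow 2).integrable_of_hasCompactSupport
    ((hc.fderiv ℝ).mono fun x hx h => hx (by simp [h]))

/-- A regularised Hardy inequality in dimension three. -/
theorem integral_sq_div_norm_sq_add_le {v : EuclideanSpace ℝ (Fin 3) → ℝ}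
    (hv : ContDiff ℝ 1 v) (hc : HasCompactSupport v) (y : EuclideanSpace ℝ (Fin 3))
    {ε : ℝ} (hε : 0 < ε) :
    ∫ x, v x ^ 2 / (‖x - y‖ ^ 2 + ε) ≤ 4 * ∫ x, ‖fderiv ℝ v x‖ ^ 2 := by
  let q : EuclideanSpace ℝ (Fin 3) → ℝ := fun x => ‖x - y‖ ^ 2 + ε
  have hq (x) : 0 < q x := by positivity
  let g : EuclideanSpace ℝ (Fin 3) → ℝ := fun x => v x ^ 2 / q x
  have hqd : ContDiff ℝ 1 q := by
    have : ContDiff ℝ 1 fun x : EuclideanSpace ℝ (Fin 3) => x - y := by fun_prop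
    exact (this.norm_sq ℝ).add contDiff_const
  have hgd : ContDiff ℝ 1 g := (hv.pow 2).div hqd fun x => (hq x).ne'
  have hgc : HasCompactSupport g := hc.mono fun x hx h => hx (by simp [g, h])
  have hgi : Integrable g := hgd.continuous.integrable_of_hasCompactSupport hgc
  have key := integral_fderiv_apply_sub hgd hgc y
  have hderiv (x) : fderiv ℝ g x (x - y) =
      2 * v x * fderiv ℝ v x (x - y) / q x - 2 * v x ^ 2 * ‖x - y‖ ^ 2 / q x ^ 2 := by
    have h1 : HasFDerivAt v (fderiv ℝ v x) x := (hv.differentiable one_ne_zero x).hasFDerivAt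
    have h2 : HasFDerivAt q _ x :=
      (((hasFDerivAt_id x).sub_const y).norm_sq).add_const ε
    have h3 : HasFDerivAt g (fderiv ℝ g x) x := (hgd.differentiable one_ne_zero x).hasFDerivAt
    have hgq : g * q = fun x => v x ^ 2 :=
      funext fun x => div_mul_cancel₀ _ (hq x).ne'
    have h4 := h3.mul h2
    have h5 := DFunLike.congr_fun ((hgq ▸ h4).unique (h1.pow 2)) (x - y)
    simp only [add_apply, smul_apply,
      ContinuousLinearMap.comp_apply, ContinuousLinearMap.id_apply, innerSL_apply_apply, id_eq,
      real_inner_self_eq_norm_sq, smul_eq_mul, nsmul_eq_mul, Nat.cast_ofNat, Nat.add_one_sub_one,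
      pow_one] at h5
    have h6 : g x = v x ^ 2 / q x := rfl
    have := (hq x).ne'
    rw [h6] at h5
    field_simp at h5 ⊢
    linear_combination h5
  have hpt (x) : -fderiv ℝ g x (x - y) ≤ 5 / 2 * g x + 2 * ‖fderiv ℝ v x‖ ^ 2 := by
    rw [hderiv]
    have hqx := hq x
    have hD : |fderiv ℝ v x (x - y)| ≤ ‖fderiv ℝ v x‖ * ‖x - y‖ :=
      (fderiv ℝ v x).le_opNorm (x - y)
    set d := fderiv ℝ v x (x - y)
    set N := ‖fderiv ℝ v x‖
    set ρ := ‖x - y‖ with hρ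
    have hle : ρ ^ 2 ≤ q x := by simp only [q, ← hρ]; linarith
    have hd2 : d ^ 2 ≤ N ^ 2 * ρ ^ 2 := by
      rw [← mul_pow, ← sq_abs d]; gcongr
    have hd2q : d ^ 2 ≤ N ^ 2 * q x := hd2.trans (by gcongr)
    have h1 : v x ^ 2 * ρ ^ 2 / q x ^ 2 ≤ g x := by
      simp only [g]
      rw [div_le_div_iff₀ (by positivity) hqx]
      nlinarith [mul_le_mul_of_nonneg_left hle (by positivity : 0 ≤ v x ^ 2 * q x)]
    have h2 : -(2 * v x * d / q x) ≤ 1 / 2 * g x + 2 * N ^ 2 := by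
      simp only [g]
      have h3 : 0 ≤ 1 / 2 * (v x + 2 * d) ^ 2 / q x := by positivity
      have h4 : d ^ 2 / q x ≤ N ^ 2 := by rwa [div_le_iff₀ hqx]
      have h5 : 1 / 2 * (v x + 2 * d) ^ 2 / q x =
        1 / 2 * (v x ^ 2 / q x) + 2 * v x * d / q x + 2 * (d ^ 2 / q x) := by ring
      linarith
    have h6 : 2 * v x ^ 2 * ρ ^ 2 / q x ^ 2 = 2 * (v x ^ 2 * ρ ^ 2 / q x ^ 2) := by ring
    linarith
  have hNi := integrable_norm_fderiv_sq hv hc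
  have hdi : Integrable fun x => fderiv ℝ g x (x - y) := by
    have hd : Continuous (fderiv ℝ g) := hgd.continuous_fderiv one_ne_zero
    refine Continuous.integrable_of_hasCompactSupport (by fun_prop) ?_
    exact (hgc.fderiv ℝ).mono fun x hx h => hx (by simp [h])
  have hmono := integral_mono hdi.neg ((hgi.const_mul (5 / 2)).add (hNi.const_mul 2)) hpt
  simp only [Pi.neg_apply, Pi.add_apply] at hmono
  rw [integral_neg, integral_add (hgi.const_mul _) (hNi.const_mul _), integral_const_mul,
    integral_const_mul, key] at hmono
  simp only [Fintype.card_fin, Nat.cast_ofNat] at hmono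
  change ∫ x, g x ≤ _
  linarith

/-- Hardy's inequality in dimension three. -/
theorem lintegral_sq_div_norm_sq_le {v : EuclideanSpace ℝ (Fin 3) → ℝ}
    (hv : ContDiff ℝ 1 v) (hc : HasCompactSupport v) (y : EuclideanSpace ℝ (Fin 3)) :
    ∫⁻ x, ENNReal.ofReal (v x ^ 2 / ‖x - y‖ ^ 2) ≤
      ENNReal.ofReal (4 * ∫ x, ‖fderiv ℝ v x‖ ^ 2) := by
  let ε : ℕ → ℝ := fun n => 1 / ((n : ℝ) + 1)
  have hε (n) : 0 < ε n := Nat.one_div_pos_of_nat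
  have hεt : Filter.Tendsto ε Filter.atTop (nhds 0) := tendsto_one_div_add_atTop_nhds_zero_nat
  let F : ℕ → EuclideanSpace ℝ (Fin 3) → ENNReal := fun n x =>
    ENNReal.ofReal (v x ^ 2 / (‖x - y‖ ^ 2 + ε n))
  have hcont (n) : Continuous fun x => v x ^ 2 / (‖x - y‖ ^ 2 + ε n) := by
    have := hv.continuous
    have := hε n
    exact Continuous.div (by fun_prop) (by fun_prop) fun x => by positivity
  have hF (n) : ∫⁻ x, F n x ≤ ENNReal.ofReal (4 * ∫ x, ‖fderiv ℝ v x‖ ^ 2) := by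
    have hi : Integrable fun x => v x ^ 2 / (‖x - y‖ ^ 2 + ε n) :=
      (hcont n).integrable_of_hasCompactSupport (hc.mono fun x hx h => hx (by simp [h]))
    have := hε n
    rw [← ofReal_integral_eq_lintegral_ofReal hi (.of_forall fun x => by positivity)]
    exact ENNReal.ofReal_le_ofReal (integral_sq_div_norm_sq_add_le hv hc y (hε n))
  calc ∫⁻ x, ENNReal.ofReal (v x ^ 2 / ‖x - y‖ ^ 2)
      ≤ ∫⁻ x, Filter.liminf (fun n => F n x) Filter.atTop := by
        refine lintegral_mono fun x => ?_
        by_cases hx : ‖x - y‖ = 0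
        · simp [hx]
        · refine (Filter.Tendsto.liminf_eq (ENNReal.tendsto_ofReal ?_)).ge
          have : Filter.Tendsto (fun n => ‖x - y‖ ^ 2 + ε n) Filter.atTop
              (nhds (‖x - y‖ ^ 2)) := by simpa using hεt.const_add (‖x - y‖ ^ 2)
          exact tendsto_const_nhds.div this (by positivity)
    _ ≤ Filter.liminf (fun n => ∫⁻ x, F n x) Filter.atTop :=
        lintegral_liminf_le fun n => (hcont n).measurable.ennreal_ofReal
    _ ≤ _ := Filter.liminf_le_of_le (by isBoundedDefault) fun b hb =>
        (hb.exists.choose_spec).trans (hF _)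

/-- The Sobolev inequality in dimension three, for functions in the unit ball of the homogeneous
Sobolev space. -/
theorem exists_lintegral_pow_six_le : ∃ K : ℝ, 0 ≤ K ∧
    ∀ v : EuclideanSpace ℝ (Fin 3) → ℝ, ContDiff ℝ 1 v → HasCompactSupport v →
      ∫ x, ‖fderiv ℝ v x‖ ^ 2 ≤ 1 → ∫⁻ x, ENNReal.ofReal (v x ^ 6) ≤ ENNReal.ofReal K := by
  let S := SNormLESNormFDerivOfEqConst ℝ (volume : Measure (EuclideanSpace ℝ (Fin 3))) 2
  refine ⟨(S : ℝ) ^ 6, by positivity, fun v hv hc h1 => ?_⟩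
  have hsob := eLpNorm_le_eLpNorm_fderiv_of_eq (F := ℝ) volume hv hc (p := 2) (p' := 6)
    (by norm_num) (by simp) (by simp; norm_num)
  have hD : eLpNorm (fderiv ℝ v) 2 volume ≤ 1 := by
    have h2 : ∫⁻ x, ‖fderiv ℝ v x‖ₑ ^ 2 ≤ 1 := by
      have := ofReal_integral_eq_lintegral_ofReal (integrable_norm_fderiv_sq hv hc)
        (.of_forall fun x => by positivity)
      calc ∫⁻ x, ‖fderiv ℝ v x‖ₑ ^ 2 = ∫⁻ x, ENNReal.ofReal (‖fderiv ℝ v x‖ ^ 2) := by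
            simp only [ENNReal.ofReal_pow (norm_nonneg _), ofReal_norm]
        _ ≤ 1 := by rw [← this]; simpa using h1
    rw [eLpNorm_eq_lintegral_rpow_enorm_toReal (by simp) (by simp)]
    refine ENNReal.rpow_le_one ?_ (by simp)
    simpa using h2
  have hv6 : eLpNorm v 6 volume ≤ S := by
    simpa using hsob.trans (mul_le_mul_right hD _)
  have h6 := eLpNorm_nnreal_pow_eq_lintegral (μ := (volume : Measure (EuclideanSpace ℝ (Fin 3))))
    (f := v) (p := 6) (by norm_num)
  calc ∫⁻ x, ENNReal.ofReal (v x ^ 6) = ∫⁻ x, ‖v x‖ₑ ^ (6 : ℝ) := by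
        refine lintegral_congr fun x => ?_
        rw [← ofReal_norm, Real.norm_eq_abs,
          ENNReal.ofReal_rpow_of_nonneg (abs_nonneg _) (by norm_num)]
        norm_cast
        rw [Even.pow_abs (by decide)]
    _ = eLpNorm v 6 volume ^ (6 : ℝ) := by simpa using h6.symm
    _ ≤ (S : ENNReal) ^ (6 : ℝ) := by gcongr
    _ = ENNReal.ofReal ((S : ℝ) ^ 6) := by
        rw [ENNReal.ofReal_pow (by positivity)]
        norm_cast
        simp

theorem pow_three_mul_rpow_le {a w : ℝ} (ha : 0 ≤ a) (hw : 0 ≤ w) :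
    a ^ (-(3 / 2) : ℝ) * w ^ 3 ≤ w ^ 2 / a ^ 2 + w ^ 6 := by
  rcases ha.eq_or_lt with rfl | ha
  · rw [Real.zero_rpow (by norm_num)]
    have : 0 ≤ w ^ 2 / (0 : ℝ) ^ 2 + w ^ 6 := by positivity
    simpa using this
  · set b := a ^ (-(1 / 2) : ℝ) with hb
    have hb0 : 0 ≤ b := by positivity
    have h3 : a ^ (-(3 / 2) : ℝ) = b ^ 3 := by
      rw [hb, ← Real.rpow_natCast, ← Real.rpow_mul ha.le]; norm_num
    have h4 : (a ^ 2)⁻¹ = b ^ 4 := by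
      rw [hb, ← Real.rpow_natCast, ← Real.rpow_natCast, ← Real.rpow_mul ha.le,
        ← Real.rpow_neg ha.le]
      norm_num
    rw [h3, div_eq_mul_inv, h4]
    have h1 : 0 ≤ w ^ 2 * ((b - w) ^ 2 * (3 * b ^ 2 + 2 * b * w + w ^ 2)) := by positivity
    have h2 : 0 ≤ w ^ 2 * b ^ 4 + 3 * w ^ 6 := by positivity
    linarith

theorem mul_mul_le_add_pow_three {a b c : ℝ} (ha : 0 ≤ a) (hb : 0 ≤ b) (hc : 0 ≤ c) :
    a * b * c ≤ a ^ 3 + b ^ 3 + c ^ 3 := by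
  have h : 0 ≤ (a + b + c) * ((a - b) ^ 2 + (b - c) ^ 2 + (c - a) ^ 2) := by positivity
  have : 0 ≤ a * b * c := by positivity
  nlinarith

/-- Interpolation between the Hardy and Sobolev inequalities, in trilinear form. -/
theorem exists_lintegral_rpow_mul_le : ∃ K : ℝ, 0 < K ∧
    ∀ (y : EuclideanSpace ℝ (Fin 3)) (v₁ v₂ v₃ : EuclideanSpace ℝ (Fin 3) → ℝ),
      ContDiff ℝ 1 v₁ → HasCompactSupport v₁ → ∫ x, ‖fderiv ℝ v₁ x‖ ^ 2 ≤ 1 →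
      ContDiff ℝ 1 v₂ → HasCompactSupport v₂ → ∫ x, ‖fderiv ℝ v₂ x‖ ^ 2 ≤ 1 →
      ContDiff ℝ 1 v₃ → HasCompactSupport v₃ → ∫ x, ‖fderiv ℝ v₃ x‖ ^ 2 ≤ 1 →
      ∫⁻ x, ENNReal.ofReal (‖x - y‖ ^ (-(3 / 2) : ℝ) * (|v₁ x| * |v₂ x| * |v₃ x|)) ≤
        ENNReal.ofReal K := by
  obtain ⟨K, hK, hS⟩ := exists_lintegral_pow_six_le
  refine ⟨3 * (4 + K), by positivity, fun y v₁ v₂ v₃ hv₁ hc₁ h₁ hv₂ hc₂ h₂ hv₃ hc₃ h₃ => ?_⟩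
  have hcube (v : EuclideanSpace ℝ (Fin 3) → ℝ) (hv : ContDiff ℝ 1 v)
      (hc : HasCompactSupport v) (h : ∫ x, ‖fderiv ℝ v x‖ ^ 2 ≤ 1) :
      ∫⁻ x, ENNReal.ofReal (‖x - y‖ ^ (-(3 / 2) : ℝ) * |v x| ^ 3) ≤ ENNReal.ofReal (4 + K) := by
    calc _ ≤ ∫⁻ x, ENNReal.ofReal (v x ^ 2 / ‖x - y‖ ^ 2) + ENNReal.ofReal (v x ^ 6) := by
          refine lintegral_mono fun x => ?_
          rw [← ENNReal.ofReal_add (by positivity) (by positivity)]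
          refine ENNReal.ofReal_le_ofReal
            ((pow_three_mul_rpow_le (norm_nonneg _) (abs_nonneg _)).trans_eq ?_)
          rw [sq_abs, Even.pow_abs (by decide)]
      _ ≤ ENNReal.ofReal 4 + ENNReal.ofReal K := by
          rw [lintegral_add_right _ (by have := hv.continuous; fun_prop)]
          refine add_le_add ((lintegral_sq_div_norm_sq_le hv hc y).trans ?_) (hS v hv hc h)
          exact ENNReal.ofReal_le_ofReal (by linarith)
      _ = _ := (ENNReal.ofReal_add (by norm_num) hK).symm
  have hmeas (v : EuclideanSpace ℝ (Fin 3) → ℝ) (hv : ContDiff ℝ 1 v) :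
      Measurable fun x => ENNReal.ofReal (‖x - y‖ ^ (-(3 / 2) : ℝ) * |v x| ^ 3) := by
    have := hv.continuous.measurable
    fun_prop
  calc _ ≤ ∫⁻ x, (ENNReal.ofReal (‖x - y‖ ^ (-(3 / 2) : ℝ) * |v₁ x| ^ 3) +
        ENNReal.ofReal (‖x - y‖ ^ (-(3 / 2) : ℝ) * |v₂ x| ^ 3)) +
        ENNReal.ofReal (‖x - y‖ ^ (-(3 / 2) : ℝ) * |v₃ x| ^ 3) := by
        refine lintegral_mono fun x => ?_
        rw [← ENNReal.ofReal_add (by positivity) (by positivity),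
          ← ENNReal.ofReal_add (by positivity) (by positivity), ← mul_add, ← mul_add]
        gcongr
        exact mul_mul_le_add_pow_three (abs_nonneg _) (abs_nonneg _) (abs_nonneg _)
    _ ≤ ENNReal.ofReal (4 + K) + ENNReal.ofReal (4 + K) + ENNReal.ofReal (4 + K) := by
        rw [lintegral_add_right _ (hmeas v₃ hv₃), lintegral_add_right _ (hmeas v₂ hv₂)]
        gcongr
        exacts [hcube v₁ hv₁ hc₁ h₁, hcube v₂ hv₂ hc₂ h₂, hcube v₃ hv₃ hc₃ h₃]
    _ = _ := by
        rw [← ENNReal.ofReal_add (by positivity) (by positivity),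
          ← ENNReal.ofReal_add (by positivity) (by positivity)]
        ring_nf

theorem mul_rpow_mul_le_of_rpow_mul_rpow_le {A B c ρ μ a b M : ℝ} (hρ : 0 < ρ) (hμ : 0 < μ)
    (hc : 0 ≤ c) (hB0 : 0 ≤ B) (hA : A ≤ c * ρ ^ a) (hB : B ≤ c * (μ⁻¹ * ρ) ^ (-b))
    (hM : ρ ^ (a - b + 3 / 2) * μ ^ (b - 3 / 2) ≤ M) :
    A * μ ^ (-(3 / 2) : ℝ) * B ≤ c ^ 2 * M * ρ ^ (-(3 / 2) : ℝ) := by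
  have h1 : (μ⁻¹ * ρ) ^ (-b) = μ ^ b * ρ ^ (-b) := by
    rw [Real.mul_rpow (by positivity) hρ.le, Real.inv_rpow hμ.le, Real.rpow_neg hμ.le, inv_inv]
  have h2 : ρ ^ (a - b + 3 / 2) * ρ ^ (-(3 / 2) : ℝ) = ρ ^ a * ρ ^ (-b) := by
    rw [← Real.rpow_add hρ, ← Real.rpow_add hρ]; ring_nf
  have h3 : μ ^ (b - 3 / 2) = μ ^ (-(3 / 2) : ℝ) * μ ^ b := by
    rw [← Real.rpow_add hμ]; ring_nf
  calc A * μ ^ (-(3 / 2) : ℝ) * B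
      ≤ c * ρ ^ a * μ ^ (-(3 / 2) : ℝ) * (c * (μ⁻¹ * ρ) ^ (-b)) := by gcongr
    _ = c ^ 2 * (μ ^ (-(3 / 2) : ℝ) * μ ^ b) * (ρ ^ a * ρ ^ (-b)) := by rw [h1]; ring
    _ = c ^ 2 * (ρ ^ (a - b + 3 / 2) * μ ^ (b - 3 / 2)) * ρ ^ (-(3 / 2) : ℝ) := by
        rw [← h2, ← h3]; ring
    _ ≤ _ := by gcongr

theorem rpow_mul_rpow_le_rpow {ρ μ a b : ℝ} (hρ : 0 < ρ) (hμ : 0 < μ)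
    (h : ρ ≤ μ ∧ 0 ≤ a - b + 3 / 2 ∨ μ ≤ ρ ∧ a - b + 3 / 2 ≤ 0) :
    ρ ^ (a - b + 3 / 2) * μ ^ (b - 3 / 2) ≤ μ ^ a := by
  have h1 : ρ ^ (a - b + 3 / 2) ≤ μ ^ (a - b + 3 / 2) := by
    rcases h with ⟨h, hp⟩ | ⟨h, hp⟩
    · exact Real.rpow_le_rpow hρ.le h hp
    · exact Real.rpow_le_rpow_of_nonpos hμ h hp
  calc _ ≤ μ ^ (a - b + 3 / 2) * μ ^ (b - 3 / 2) := by gcongr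
    _ = μ ^ a := by rw [← Real.rpow_add hμ]; ring_nf

theorem rpow_mul_rpow_le_of_one {ρ μ p q : ℝ} (hρ : 0 < ρ) (hμ : 0 < μ)
    (h : ρ ≤ 1 ∧ 0 ≤ p ∨ 1 ≤ ρ ∧ p ≤ 0) : ρ ^ p * μ ^ q ≤ μ ^ q := by
  refine mul_le_of_le_one_left (by positivity) ?_
  rcases h with ⟨h, hp⟩ | ⟨h, hp⟩
  · exact Real.rpow_le_one hρ.le h hp
  · exact Real.rpow_le_one_of_one_le_of_nonpos h hp

theorem stmt7 (τ Cr : ℝ) (hτ : 0 < τ) (hCr : 0 < Cr) :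
    ∃ C > (0 : ℝ), ∀ (y : EuclideanSpace ℝ (Fin 3)) (σ σ' s m : ℝ)
      (f r : EuclideanSpace ℝ (Fin 3) → ℝ),
      0 ≤ σ → 0 ≤ σ' → 0 < s → 0 < m → Measurable f → Measurable r →
      (∀ x ∈ Metric.ball y 1, |r x| ≤ Cr * ‖x - y‖ ^ σ) →
      (∀ x ∉ Metric.ball y 1, |r x| ≤ Cr * ‖x - y‖ ^ σ') →
      (∀ x ∈ Metric.ball (0 : EuclideanSpace ℝ (Fin 3)) 1, |f x| ≤ Cr * ‖x‖ ^ (-s)) →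
      (∀ x ∉ Metric.ball (0 : EuclideanSpace ℝ (Fin 3)) 1, |f x| ≤ Cr * ‖x‖ ^ (-m)) →
      σ ≤ m - 3 / 2 - τ → σ' ≤ m - 3 / 2 - τ → s + τ < σ + 3 / 2 →
      ∀ μ : ℝ, 0 < μ →
      ∀ v₁ v₂ v₃ : EuclideanSpace ℝ (Fin 3) → ℝ,
        ContDiff ℝ (⊤ : ℕ∞) v₁ → HasCompactSupport v₁ → (∫ x, ‖gradient v₁ x‖ ^ 2) ≤ 1 →
        ContDiff ℝ (⊤ : ℕ∞) v₂ → HasCompactSupport v₂ → (∫ x, ‖gradient v₂ x‖ ^ 2) ≤ 1 →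
        ContDiff ℝ (⊤ : ℕ∞) v₃ → HasCompactSupport v₃ → (∫ x, ‖gradient v₃ x‖ ^ 2) ≤ 1 →
        (μ ≤ 1 →
          (∫⁻ x, ENNReal.ofReal
              (|r x| * μ ^ (-(3 / 2) : ℝ) * |f (μ⁻¹ • (x - y))| * |v₁ x| * |v₂ x| * |v₃ x|))
            ≤ ENNReal.ofReal (C * μ ^ σ)) ∧
        (1 < μ →
          (∫⁻ x, ENNReal.ofReal
              (|r x| * μ ^ (-(3 / 2) : ℝ) * |f (μ⁻¹ • (x - y))| * |v₁ x| * |v₂ x| * |v₃ x|))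
            ≤ ENNReal.ofReal (C * (μ ^ (s - 3 / 2) + μ ^ σ'))) := by
  obtain ⟨K, hK, hmain⟩ := exists_lintegral_rpow_mul_le
  refine ⟨Cr ^ 2 * K, by positivity, ?_⟩
  intro y σ σ' s m f r hσ hσ' hs hm _ _ hr hr' hf hf' hσm hσm' hsσ μ hμ v₁ v₂ v₃
    hv₁ hc₁ h₁ hv₂ hc₂ h₂ hv₃ hc₃ h₃
  simp only [norm_gradient_eq_norm_fderiv] at h₁ h₂ h₃
  have hint := hmain y v₁ v₂ v₃ (hv₁.of_le (by simp)) hc₁ h₁ (hv₂.of_le (by simp)) hc₂ h₂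
    (hv₃.of_le (by simp)) hc₃ h₃
  have hnorm (x) : ‖μ⁻¹ • (x - y)‖ = μ⁻¹ * ‖x - y‖ := by
    rw [norm_smul, Real.norm_of_nonneg (by positivity)]
  have hr_in (x) (h : ‖x - y‖ < 1) : |r x| ≤ Cr * ‖x - y‖ ^ σ := hr x (by simpa [dist_eq_norm])
  have hr_out (x) (h : 1 ≤ ‖x - y‖) : |r x| ≤ Cr * ‖x - y‖ ^ σ' :=
    hr' x (by simpa [dist_eq_norm])
  have hf_in (x) (h : ‖x - y‖ < μ) :
      |f (μ⁻¹ • (x - y))| ≤ Cr * (μ⁻¹ * ‖x - y‖) ^ (-s) := by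
    rw [← hnorm]
    refine hf _ ?_
    rwa [mem_ball_zero_iff, hnorm, inv_mul_lt_one₀ hμ]
  have hf_out (x) (h : μ ≤ ‖x - y‖) :
      |f (μ⁻¹ • (x - y))| ≤ Cr * (μ⁻¹ * ‖x - y‖) ^ (-m) := by
    rw [← hnorm]
    refine hf' _ ?_
    rwa [mem_ball_zero_iff, hnorm, inv_mul_lt_one₀ hμ, not_lt]
  have hf_zero : f 0 = 0 := by
    have := hf 0 (by simp)
    rw [norm_zero, Real.zero_rpow (by linarith), mul_zero] at this
    exact abs_nonpos_iff.mp this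
  have hfinal (M : ℝ) (hM0 : 0 ≤ M)
      (hM : ∀ x, 0 < ‖x - y‖ → |r x| * μ ^ (-(3 / 2) : ℝ) * |f (μ⁻¹ • (x - y))| ≤
        Cr ^ 2 * M * ‖x - y‖ ^ (-(3 / 2) : ℝ)) :
      (∫⁻ x, ENNReal.ofReal
        (|r x| * μ ^ (-(3 / 2) : ℝ) * |f (μ⁻¹ • (x - y))| * |v₁ x| * |v₂ x| * |v₃ x|)) ≤
        ENNReal.ofReal (Cr ^ 2 * K * M) := by
    calc _ ≤ ∫⁻ x, ENNReal.ofReal (Cr ^ 2 * M) *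
          ENNReal.ofReal (‖x - y‖ ^ (-(3 / 2) : ℝ) * (|v₁ x| * |v₂ x| * |v₃ x|)) := by
          refine lintegral_mono fun x => ?_
          rw [← ENNReal.ofReal_mul (by positivity)]
          refine ENNReal.ofReal_le_ofReal ?_
          rcases (norm_nonneg (x - y)).eq_or_lt with h | h
          · rw [norm_eq_zero.mp h.symm, smul_zero, hf_zero]
            simp only [abs_zero, mul_zero, zero_mul]
            positivity
          · rw [mul_assoc _ |v₁ x|, mul_assoc _ _ |v₃ x|, ← mul_assoc (Cr ^ 2 * M)]
            exact mul_le_mul_of_nonneg_right (hM x h) (by positivity)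
      _ ≤ ENNReal.ofReal (Cr ^ 2 * M) * ENNReal.ofReal K := by
          rw [lintegral_const_mul' _ _ ENNReal.ofReal_ne_top]
          gcongr
      _ = _ := by rw [← ENNReal.ofReal_mul (by positivity)]; ring_nf
  refine ⟨fun hμ1 => hfinal _ (by positivity) fun x hx => ?_,
    fun hμ1 => hfinal _ (by positivity) fun x hx => ?_⟩
  · rcases lt_or_ge ‖x - y‖ μ with h | h
    · exact mul_rpow_mul_le_of_rpow_mul_rpow_le hx hμ hCr.le (abs_nonneg _)
        (hr_in x (by linarith)) (hf_in x h)
        (rpow_mul_rpow_le_rpow hx hμ (.inl ⟨h.le, by linarith⟩))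
    rcases lt_or_ge ‖x - y‖ 1 with h1 | h1
    · exact mul_rpow_mul_le_of_rpow_mul_rpow_le hx hμ hCr.le (abs_nonneg _)
        (hr_in x h1) (hf_out x h) (rpow_mul_rpow_le_rpow hx hμ (.inr ⟨h, by linarith⟩))
    · exact mul_rpow_mul_le_of_rpow_mul_rpow_le hx hμ hCr.le (abs_nonneg _)
        (hr_out x h1) (hf_out x h)
        ((rpow_mul_rpow_le_of_one hx hμ (.inr ⟨h1, by linarith⟩)).trans
          (Real.rpow_le_rpow_of_exponent_ge hμ hμ1 (by linarith)))
  · have hle₁ : μ ^ (s - 3 / 2) ≤ μ ^ (s - 3 / 2) + μ ^ σ' :=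
      le_add_of_nonneg_right (by positivity)
    have hle₂ : μ ^ σ' ≤ μ ^ (s - 3 / 2) + μ ^ σ' := le_add_of_nonneg_left (by positivity)
    rcases lt_or_ge ‖x - y‖ 1 with h1 | h1
    · exact mul_rpow_mul_le_of_rpow_mul_rpow_le hx hμ hCr.le (abs_nonneg _)
        (hr_in x h1) (hf_in x (by linarith))
        ((rpow_mul_rpow_le_of_one hx hμ (.inl ⟨h1.le, by linarith⟩)).trans hle₁)
    rcases lt_or_ge ‖x - y‖ μ with h | h
    · refine mul_rpow_mul_le_of_rpow_mul_rpow_le hx hμ hCr.le (abs_nonneg _)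
        (hr_out x h1) (hf_in x h) ?_
      rcases le_total (σ' - s + 3 / 2) 0 with hp | hp
      · exact (rpow_mul_rpow_le_of_one hx hμ (.inr ⟨h1, hp⟩)).trans hle₁
      · exact (rpow_mul_rpow_le_rpow hx hμ (.inl ⟨h.le, hp⟩)).trans hle₂
    · exact mul_rpow_mul_le_of_rpow_mul_rpow_le hx hμ hCr.le (abs_nonneg _)
        (hr_out x h1) (hf_out x h)
        ((rpow_mul_rpow_le_rpow hx hμ (.inr ⟨h, by linarith⟩)).trans hle₂)
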